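/- Let M be a strongly homogeneous L-structure, A ⊆ M a set of parameters, B a tuple from M, and (c_i)_{i<α} a sequence of elements of M. If for every i < α the element c_i is weakly orthogonal to B over A ∪ {c_j : j < i}, then the tuple c_{<α} = (c_i)_{i<α} is weakly orthogonal to B over A. -/

import Mathlib

open FirstOrder FirstOrder.Language Set

universe u v w

/-- `b ≡_A b'`: the tuples `b` and `b'` satisfy the same first-order `L`-formulas with
parameters from `A` in `M`. -/
def SameType (L : FirstOrder.Language.{u, v}) {M : Type w} [L.Structure M] (A : Set M)
    {ι : Type*} (b b' : ι → M) : Prop :=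
  ∀ (m : ℕ) (φ : L.Formula (ι ⊕ Fin m)) (p : Fin m → M), (∀ k, p k ∈ A) →
    (φ.Realize (Sum.elim b p) ↔ φ.Realize (Sum.elim b' p))

/-- The formula `φ` with parameters `p` isolates the type of the tuple `b` over the
parameter set `P`. -/
def Isolates {L : FirstOrder.Language.{u, v}} {M : Type w} [L.Structure M] {ι : Type*} {m : ℕ}
    (φ : L.Formula (ι ⊕ Fin m)) (p : Fin m → M) (P : Set M) (b : ι → M) : Prop :=
  φ.Realize (Sum.elim b p) ∧ ∀ c : ι → M, φ.Realize (Sum.elim c p) → SameType L P c b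

/-- The type `tp(b/P)` is isolated: some formula with parameters from `P` isolates it. -/
def IsolatedType (L : FirstOrder.Language.{u, v}) {M : Type w} [L.Structure M] (P : Set M)
    {ι : Type*} (b : ι → M) : Prop :=
  ∃ (m : ℕ) (φ : L.Formula (ι ⊕ Fin m)) (p : Fin m → M),
    (∀ k, p k ∈ P) ∧ Isolates φ p P b

/-- `(b_i)` is a construction sequence over `A`: each `tp(b_i / A ∪ {b_j : j < i})` is
isolated. -/
def IsConstructionSequence (L : FirstOrder.Language.{u, v}) {M : Type w} [L.Structure M]
    (A : Set M) {ι : Type*} [LinearOrder ι] (b : ι → M) : Prop :=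
  ∀ i : ι, IsolatedType L (A ∪ b '' {j | j < i}) ![b i]

/-- `B ⫛^wo_A C`: the tuples `B` and `C` are weakly orthogonal over `A`. -/
def WeaklyOrthogonal (L : FirstOrder.Language.{u, v}) {M : Type w} [L.Structure M] (A : Set M)
    {ιB ιC : Type*} (B : ιB → M) (C : ιC → M) : Prop :=
  ∀ (B' : ιB → M) (C' : ιC → M), SameType L A B' B → SameType L A C' C →
    SameType L A (Sum.elim B' C') (Sum.elim B C)

/-- `f` is an elementary map on the subset `S` of `M`. -/
def IsElementaryMapOn (L : FirstOrder.Language.{u, v}) {M : Type w} [L.Structure M]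
    (S : Set M) (f : M → M) : Prop :=
  ∀ (n : ℕ) (φ : L.Formula (Fin n)) (a : Fin n → M), (∀ k, a k ∈ S) →
    (φ.Realize a ↔ φ.Realize (f ∘ a))

/-- `M` is strongly homogeneous: any two tuples with the same type over a set of parameters
are conjugate by an automorphism fixing those parameters pointwise. -/
def StronglyHomogeneous (L : FirstOrder.Language.{u, v}) (M : Type w) [L.Structure M] : Prop :=
  ∀ (P : Set M) (ι : Type w) (x y : ι → M), SameType L P x y →
    ∃ σ : M ≃[L] M, (∀ a ∈ P, σ a = a) ∧ ∀ i, σ (x i) = y i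

namespace SameType

variable {L : FirstOrder.Language.{u, v}} {M : Type w} [L.Structure M]

theorem symm {P : Set M} {κ : Type*} {x y : κ → M} (hxy : SameType L P x y) :
    SameType L P y x :=
  fun m φ p hp => (hxy m φ p hp).symm

theorem trans {P : Set M} {κ : Type*} {x y z : κ → M} (hxy : SameType L P x y)
    (hyz : SameType L P y z) : SameType L P x z :=
  fun m φ p hp => (hxy m φ p hp).trans (hyz m φ p hp)

/-- A tuple and its image under an automorphism fixing `P` pointwise have the same type
over `P`. -/
theorem of_equiv {P : Set M} {κ : Type*} {x y : κ → M} (σ : M ≃[L] M)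
    (hσ : ∀ a ∈ P, σ a = a) (hxy : ∀ i, σ (x i) = y i) : SameType L P x y := by
  intro m φ p hp
  have hcomp : σ ∘ Sum.elim x p = Sum.elim y p := by
    ext (i | k)
    · exact hxy i
    · exact hσ _ (hp k)
  rw [← hcomp, StrongHomClass.realize_formula]

/-- The parameters may be indexed by an arbitrary finite type. -/
theorem realize_iff {P : Set M} {κ : Type*} {x y : κ → M} (h : SameType L P x y)
    {τ : Type*} [Finite τ] (φ : L.Formula (κ ⊕ τ)) (p : τ → M) (hp : ∀ k, p k ∈ P) :
    φ.Realize (Sum.elim x p) ↔ φ.Realize (Sum.elim y p) := by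
  obtain ⟨n, ⟨e⟩⟩ := Finite.exists_equiv_fin τ
  have key := h n (φ.relabel (Sum.map id e)) (p ∘ e.symm) fun k => hp _
  have hcomp : ∀ z : κ → M, Sum.elim z (p ∘ e.symm) ∘ Sum.map id e = Sum.elim z p := by
    intro z
    ext (i | k) <;> simp
  simpa only [Formula.realize_relabel, hcomp] using key

/-- A common part of two tuples of the same type may be added to the parameters. -/
theorem union_range {P : Set M} {κ κ' : Type*} {z : κ → M} {x y : κ' → M}
    (h : SameType L P (Sum.elim z x) (Sum.elim z y)) : SameType L (P ∪ range z) x y := by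
  classical
  intro m φ p hp
  have hz : ∀ k : {k // p k ∉ P}, ∃ i, z i = p k := fun k => (hp k).resolve_left k.2
  choose f hf using hz
  let g : κ' ⊕ Fin m → (κ ⊕ κ') ⊕ {k // p k ∈ P} :=
    Sum.elim (Sum.inl ∘ Sum.inr)
      fun k => if hk : p k ∈ P then Sum.inr ⟨k, hk⟩ else Sum.inl (Sum.inl (f ⟨k, hk⟩))
  have key := h.realize_iff (φ.relabel g) (fun k => p k) fun k => k.2
  have hcomp : ∀ w : κ' → M,
      Sum.elim (Sum.elim z w) (fun k : {k // p k ∈ P} => p k) ∘ g = Sum.elim w p := by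
    intro w
    ext (i | k)
    · rfl
    · by_cases hk : p k ∈ P <;> simp [g, hk, hf]
  simpa only [Formula.realize_relabel, hcomp] using key

/-- Equality of types over `A ∪ c '' D` can be checked over the initial segments of `c`
cut off by the elements of `D`. -/
theorem union_image {A : Set M} {κ : Type*} {x y : κ → M} {ι : Type*} [LinearOrder ι]
    {c : ι → M} {D : Set ι} (hA : SameType L A x y)
    (hD : ∀ j ∈ D, SameType L (A ∪ c '' Iic j) x y) : SameType L (A ∪ c '' D) x y := by
  rcases D.eq_empty_or_nonempty with rfl | ⟨j₀, hj₀⟩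
  · simpa using hA
  intro m φ p hp
  have hj : ∀ k, ∃ j : D, p k ∈ A ∪ c '' Iic j.1 := by
    intro k
    rcases hp k with hk | ⟨j, hj, hk⟩
    · exact ⟨⟨j₀, hj₀⟩, Or.inl hk⟩
    · exact ⟨⟨j, hj⟩, Or.inr ⟨j, le_rfl, hk⟩⟩
  choose f hf using hj
  have : Nonempty D := ⟨⟨j₀, hj₀⟩⟩
  obtain ⟨j, hj⟩ := Finite.exists_le f
  exact hD j j.2 m φ p fun k =>
    union_subset_union_right A (image_mono (Iic_subset_Iic.2 (Subtype.coe_le_coe.2 (hj k))))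
      (hf k)

end SameType

/-- If each `c_i` is weakly orthogonal to `B` over `A ∪ {c_j : j < i}`, then
the whole tuple `(c_i)_{i<α}` is weakly orthogonal to `B` over `A`. -/
theorem weaklyOrthogonal_of_pointwise
    {L : FirstOrder.Language.{u, v}} {M : Type w} [L.Structure M]
    (hM : StronglyHomogeneous L M) (A : Set M)
    {ιB : Type w} (B : ιB → M)
    {ι : Type w} [LinearOrder ι] [WellFoundedLT ι] (c : ι → M)
    (h : ∀ i : ι, WeaklyOrthogonal L (A ∪ c '' {j | j < i}) ![c i] B) :
    WeaklyOrthogonal L A c B := by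
  intro c' B' hc hB
  obtain ⟨σ, hσA, hσ⟩ := hM A ι c' c hc
  have hB' : SameType L A (σ ∘ B') B :=
    (SameType.of_equiv σ hσA fun _ => rfl).symm.trans hB
  have hIic : ∀ i, SameType L (A ∪ c '' Iic i) (σ ∘ B') B := by
    intro i
    induction i using WellFoundedLT.induction with
    | ind i ih =>
      have hlt : SameType L (A ∪ c '' {j | j < i}) (σ ∘ B') B := hB'.union_image ih
      have hle := (h i ![c i] (σ ∘ B') (fun _ _ _ _ => Iff.rfl) hlt).union_range
      rwa [Matrix.range_cons, Matrix.range_empty, union_empty, union_assoc,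
        ← image_singleton, ← image_union, show {j | j < i} ∪ {i} = Iic i from Iio_union_right]
        at hle
  have huniv : SameType L (A ∪ c '' univ) (σ ∘ B') B := hB'.union_image fun i _ => hIic i
  obtain ⟨τ, hτA, hτ⟩ := hM _ ιB _ _ huniv
  refine SameType.of_equiv (τ.comp σ) (fun a ha => ?_) ?_
  · simp [hσA a ha, hτA a (Or.inl ha)]
  · rintro (i | i)
    · simpa [hσ i] using hτA (c i) (Or.inr ⟨i, trivial, rfl⟩)
    · simpa using hτ i
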